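/- Let P be a PDA in reduced form, let k ≥ 1, and let r = I_0, …, I_m be a quasi-run of the k-oscillating PDA P^(k). If annot(stack(I_0)) = d, then h_d ≼ α(r) and h_{d+1} ⋠ α(r) (so r is d-oscillating); if annot(stack(I_0)) = d̂, then ĥ_d ≼ α(r) and h_{d+1} ⋠ α(r). -/

import Mathlib

/-- The two-letter Dyck alphabet: `D.ab` is `ā` (the opening symbol) and `D.a` is `a`
(the closing symbol). -/
inductive D where
  | ab : D  -- ā
  | a : D   -- a
deriving DecidableEq

/-- Parse trees of the grammar `G_D = ({S}, {ā, a}, S, {S → ā S a S, S → ε})`: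
`eps` is an application of `S → ε` and `node t₁ t₂` an application of `S → ā S a S`. -/
inductive DyckTree where
  | eps : DyckTree
  | node : DyckTree → DyckTree → DyckTree

/-- The word generated by a parse tree of `G_D`. -/
def DyckTree.yield : DyckTree → List D
  | .eps => []
  | .node t₁ t₂ => D.ab :: (t₁.yield ++ D.a :: t₂.yield)

/-- The Dyck language `L_D`: the language generated by `G_D`. -/
def LD : Set (List D) := { w | ∃ t : DyckTree, t.yield = w }

/-- `Matches t i j` holds iff positions `i < j` (0-indexed) of the word `t.yield` form a
matching pair: position `i` carries `ā`, position `j` carries `a`, and the two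
corresponding leaves have the same parent in the parse tree `t`. -/
inductive Matches : DyckTree → ℕ → ℕ → Prop
  | head (t₁ t₂ : DyckTree) : Matches (.node t₁ t₂) 0 (t₁.yield.length + 1)
  | left {t₁ : DyckTree} {i j : ℕ} (t₂ : DyckTree) :
      Matches t₁ i j → Matches (.node t₁ t₂) (i + 1) (j + 1)
  | right {t₂ : DyckTree} {i j : ℕ} (t₁ : DyckTree) :
      Matches t₂ i j → Matches (.node t₁ t₂) (t₁.yield.length + 2 + i) (t₁.yield.length + 2 + j)

/-- `DelStep w v`: `v` results from `w ∈ L_D` by deleting (both positions of) one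
matching pair of `w`. -/
def DelStep (w v : List D) : Prop :=
  ∃ (t : DyckTree) (i j : ℕ), t.yield = w ∧ Matches t i j ∧
    v = (w.eraseIdx j).eraseIdx i

/-- The ordering `≼` on Dyck words: `dyckLE v w` (i.e. `v ≼ w`) holds iff `v` results
from `w` by deleting 0 or more matching pairs. -/
def dyckLE (v w : List D) : Prop := Relation.ReflTransGen DelStep w v

/-- The harmonics: `h_0 = ε` and `h_{i+1} = ā h_i a ā h_i a`. -/
def harmonicW : ℕ → List D
  | 0 => []
  | i + 1 => (D.ab :: (harmonicW i ++ [D.a])) ++ (D.ab :: (harmonicW i ++ [D.a]))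

/-- `ĥ_i = ā h_i a`. -/
def hatHarmonic (i : ℕ) : List D := D.ab :: (harmonicW i ++ [D.a])

/-- The rank of a Dyck word `w`: the greatest `q` such that `h_q ≼ w`. -/
noncomputable def rank (w : List D) : ℕ := sSup { q : ℕ | dyckLE (harmonicW q) w }

/-- A pushdown automaton with states `Q`, input alphabet `σ` and stack alphabet `Γ`
(the types `Q`, `σ`, `Γ` are meant to be finite, which is required where relevant):
`δ` is the set of actions, an action `(q, b, γ, p, ξ)` standing for
`(q, b, γ) ↪ (p, ξ)` with `b ∈ Σ ∪ {ε}` encoded by `Option σ`; `q0` is the start state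
and `γ0` the start stack symbol. Acceptance is by empty stack. -/
structure PDA (Q σ Γ : Type) where
  δ : Set (Q × Option σ × Γ × Q × List Γ)
  q0 : Q
  γ0 : Γ

/-- An instantaneous descriptor: state, remaining input, stack content. -/
structure ID (Q σ Γ : Type) where
  state : Q
  tape : List σ
  stack : List Γ

/-- The move relation: an action `(q, b, γ) ↪ (p, ξ′)` induces the move
`(q, b w, γ ξ) ⊢ (p, w, ξ′ ξ)`. -/
def PDA.Move {Q σ Γ : Type} (P : PDA Q σ Γ) (I I' : ID Q σ Γ) : Prop :=
  ∃ (b : Option σ) (γ : Γ) (ξ rest : List Γ),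
    (I.state, b, γ, I'.state, ξ) ∈ P.δ ∧
    I.stack = γ :: rest ∧ I'.stack = ξ ++ rest ∧
    I.tape = b.toList ++ I'.tape

/-- A quasi-run: a move sequence `I₀ ⊢ I₁ ⊢ … ⊢ I_m` such that the stack of `I₀` is a
single symbol and the stack of `I_m` is empty (represented as the list `[I₀, …, I_m]`). -/
def PDA.IsQuasiRun {Q σ Γ : Type} (P : PDA Q σ Γ) (r : List (ID Q σ Γ)) : Prop :=
  r.Chain' P.Move ∧
  (∃ (I : ID Q σ Γ) (γ : Γ), r.head? = some I ∧ I.stack = [γ]) ∧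
  (∃ I' : ID Q σ Γ, r.getLast? = some I' ∧ I'.stack = [])

/-- A run on input `w`: a quasi-run whose first ID is the initial ID `(q₀, w, γ₀)` and
whose last ID has empty tape (and, being a quasi-run, empty stack). -/
def PDA.IsRun {Q σ Γ : Type} (P : PDA Q σ Γ) (w : List σ) (r : List (ID Q σ Γ)) : Prop :=
  P.IsQuasiRun r ∧ r.head? = some ⟨P.q0, w, [P.γ0]⟩ ∧
  (∃ I' : ID Q σ Γ, r.getLast? = some I' ∧ I'.tape = [])

/-- The language of `P` (acceptance by empty stack). -/
def PDA.lang {Q σ Γ : Type} (P : PDA Q σ Γ) : Set (List σ) := { w | ∃ r, P.IsRun w r }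

/-- The footprint `α′(r)` of a quasi-run `r = I₀, …, I_m`, defined in the paper by
disassembly: `α′(r) = a` if `m = 1`, and `α′(r) = a ā^d α′(r₁) … α′(r_d)` if `m > 1`,
where `d = |stack(I₁)|` and `r₁, …, r_d` is the disassembly of `r`.  Equivalently
(unfolding the disassembly), each move `I ⊢ I'` contributes `a` (for the popped
symbol) followed by `ā^{|ξ|}` where `|ξ| = |stack(I')| + 1 − |stack(I)|` is the number
of pushed symbols; this computation is used here. -/
def alphaQR' {Q σ Γ : Type} : List (ID Q σ Γ) → List D
  | I :: I' :: rest =>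
      (D.a :: List.replicate (I'.stack.length + 1 - I.stack.length) D.ab) ++
        alphaQR' (I' :: rest)
  | _ => []

/-- The footprint `α(r) = ā α′(r)` of a quasi-run `r`. -/
def alphaQR {Q σ Γ : Type} (r : List (ID Q σ Γ)) : List D := D.ab :: alphaQR' r

/-- The oscillation of a quasi-run: `osc(r) = rank(α(r))`. -/
noncomputable def oscQR {Q σ Γ : Type} (r : List (ID Q σ Γ)) : ℕ := rank (alphaQR r)

/-- `L^(k)(P)`: the set of words accepted by some `k`-oscillating run of `P`. -/
noncomputable def PDA.oscLang {Q σ Γ : Type} (P : PDA Q σ Γ) (k : ℕ) : Set (List σ) :=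
  { w | ∃ r, P.IsRun w r ∧ oscQR r = k }

/-- A PDA is in reduced form if it has a single state (`Q = PUnit`) and each action
pops a symbol (`ξ = ε`) or pushes two symbols (`ξ ∈ Γ²`). -/
def PDA.Reduced {σ Γ : Type} (P : PDA PUnit σ Γ) : Prop :=
  ∀ a ∈ P.δ, (a.2.2.2.2 : List Γ).length = 2 ∨ a.2.2.2.2 = []

/-- For IDs `I, I'` with `stack(I) = ξ stack(I')`, `I/I' = (state(I), tape(I), ξ)`. -/
def quotID {Q σ Γ : Type} (I I' : ID Q σ Γ) : ID Q σ Γ :=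
  ⟨I.state, I.tape, I.stack.take (I.stack.length - I'.stack.length)⟩

instance {σ Γ : Type} : Inhabited (ID PUnit σ Γ) := ⟨⟨PUnit.unit, [], []⟩⟩

/-- The segment `I_s/I_e, I_{s+1}/I_e, …, I_e/I_e` of a quasi-run `r = I₀, …, I_m`,
for positions `s ≤ e`. -/
def segmentQR {σ Γ : Type} (r : List (ID PUnit σ Γ)) (s e : ℕ) : List (ID PUnit σ Γ) :=
  (List.range (e - s + 1)).map (fun j => quotID (r.getD (s + j) default) (r.getD e default))

/-- Annotated stack symbols: `(γ, d, false)` encodes `γ^(d)` and `(γ, d, true)` encodes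
`γ̂^(d)` (annotation `d` resp. `d̂`). -/
abbrev AnnSym (Γ : Type) := Γ × ℕ × Bool

/-- The `k`-oscillating PDA `P^(k)` obtained from a PDA `P` in reduced form: it has the
single state `q`, stack alphabet `Γ′(k)` of annotated symbols, start symbol `γ₀^(k)`,
and its actions `δ^(k)` are exactly:
(1) for each pop action `(q, b, γ) ↪ (q, ε)` of `P`, the actions
    `(q, b, γ^(0)) ↪ (q, ε)` and `(q, b, γ̂^(0)) ↪ (q, ε)`;
(2) for each push action `(q, b, γ) ↪ (q, ξ)` of `P` with `ξ = ξ₁ ξ₂ ∈ Γ²`, for every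
    `d` with `1 ≤ d ≤ k` and every `ℓ` with `0 ≤ ℓ ≤ d − 1`, the actions
    (a) `(q, b, γ̂^(d)) ↪ (q, ξ₁^(d) ξ₂^(ℓ))`,
    (b) `(q, b, γ̂^(d)) ↪ (q, ξ₁^(ℓ) ξ̂₂^(d))`,
    (c) `(q, b, γ^(d)) ↪ (q, ξ₁^(d) ξ₂^(ℓ))`,
    (d) `(q, b, γ^(d)) ↪ (q, ξ₁^(ℓ) ξ₂^(d))`,
    (e) `(q, b, γ^(d)) ↪ (q, ξ₁^(d−1) ξ̂₂^(d−1))`. -/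
def annPDA {σ Γ : Type} (P : PDA PUnit σ Γ) (k : ℕ) : PDA PUnit σ (AnnSym Γ) where
  q0 := PUnit.unit
  γ0 := (P.γ0, k, false)
  δ := { act |
    -- (1) pop actions
    (∃ (b : Option σ) (γ : Γ) (h : Bool),
      (PUnit.unit, b, γ, PUnit.unit, ([] : List Γ)) ∈ P.δ ∧
      act = (PUnit.unit, b, (γ, 0, h), PUnit.unit, [])) ∨
    -- (2) (a)-(d)
    (∃ (b : Option σ) (γ ξ₁ ξ₂ : Γ) (d ℓ : ℕ),
      (PUnit.unit, b, γ, PUnit.unit, [ξ₁, ξ₂]) ∈ P.δ ∧ 1 ≤ d ∧ d ≤ k ∧ ℓ ≤ d - 1 ∧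
      (act = (PUnit.unit, b, (γ, d, true), PUnit.unit, [(ξ₁, d, false), (ξ₂, ℓ, false)]) ∨
       act = (PUnit.unit, b, (γ, d, true), PUnit.unit, [(ξ₁, ℓ, false), (ξ₂, d, true)]) ∨
       act = (PUnit.unit, b, (γ, d, false), PUnit.unit, [(ξ₁, d, false), (ξ₂, ℓ, false)]) ∨
       act = (PUnit.unit, b, (γ, d, false), PUnit.unit, [(ξ₁, ℓ, false), (ξ₂, d, false)]))) ∨
    -- (2) (e)
    (∃ (b : Option σ) (γ ξ₁ ξ₂ : Γ) (d : ℕ),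
      (PUnit.unit, b, γ, PUnit.unit, [ξ₁, ξ₂]) ∈ P.δ ∧ 1 ≤ d ∧ d ≤ k ∧
      act = (PUnit.unit, b, (γ, d, false), PUnit.unit,
             [(ξ₁, d - 1, false), (ξ₂, d - 1, true)])) }

namespace DyckTree

/-- Concatenation of the forests encoded by two parse trees. -/
def append : DyckTree → DyckTree → DyckTree
  | .eps, s => s
  | .node a b, s => .node a (b.append s)

theorem append_eps (t : DyckTree) : t.append .eps = t := by
  induction t with
  | eps => rfl
  | node a b _ ihb => simp [append, ihb]

theorem yield_append (t s : DyckTree) : (t.append s).yield = t.yield ++ s.yield := by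
  induction t with
  | eps => rfl
  | node a b _ ihb => simp [append, yield, ihb]

theorem eq_of_yield_append_eq {t s : DyckTree} {x y : List D}
    (h : t.yield ++ D.a :: x = s.yield ++ D.a :: y) : t = s := by
  induction t generalizing s x y with
  | eps => cases s <;> simp_all [yield]
  | node a b iha ihb =>
    cases s with
    | eps => simp [yield] at h
    | node a' b' =>
      simp only [yield, List.cons_append, List.append_assoc, List.cons.injEq, true_and] at h
      obtain rfl := iha h
      simp only [List.append_cancel_left_eq, List.cons.injEq, true_and] at h
      rw [ihb h]

theorem yield_injective : Function.Injective yield := fun _ _ h =>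
  eq_of_yield_append_eq (x := []) (y := []) (by rw [h])

/-- Deletion of one node of a forest, its children taking its place. -/
inductive Del : DyckTree → DyckTree → Prop
  | head (a b : DyckTree) : Del (.node a b) (a.append b)
  | left {a a' : DyckTree} (b : DyckTree) : Del a a' → Del (.node a b) (.node a' b)
  | right {b b' : DyckTree} (a : DyckTree) : Del b b' → Del (.node a b) (.node a b')

theorem Del.append_left {t s : DyckTree} (h : Del t s) (u : DyckTree) :
    Del (t.append u) (s.append u) := by
  induction h with
  | head a b =>
    have assoc : (a.append b).append u = a.append (b.append u) :=
      yield_injective (by simp [yield_append])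
    rw [assoc]
    exact .head _ _
  | left b h _ => exact .left _ h
  | right a _ ih => exact .right _ ih

theorem Del.append_right {t s : DyckTree} (h : Del t s) (u : DyckTree) :
    Del (u.append t) (u.append s) := by
  induction u with
  | eps => exact h
  | node a b _ ihb => exact .right _ ihb

/-- `Emb t s`: the forest `s` results from `t` by deleting nodes. -/
abbrev Emb : DyckTree → DyckTree → Prop := Relation.ReflTransGen Del

theorem emb_eps (t : DyckTree) : Emb t .eps := by
  induction t with
  | eps => exact .refl
  | node a b iha ihb =>
    have h : Emb (a.append b) (DyckTree.eps.append b) :=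
      iha.lift (·.append b) fun _ _ h => h.append_left b
    exact .head (.head a b) (h.trans ihb)

theorem emb_node_right (a b : DyckTree) : Emb (.node a b) b :=
  .head (.head a b) ((emb_eps a).lift (·.append b) fun _ _ h => h.append_left b)

theorem emb_node_left (a b : DyckTree) : Emb (.node a b) a := by
  have h : Emb (a.append b) (a.append .eps) :=
    (emb_eps b).lift (a.append ·) fun _ _ h => h.append_right a
  rw [append_eps] at h
  exact .head (.head a b) h

theorem Emb.node {a a' b b' : DyckTree} (ha : Emb a a') (hb : Emb b b') :
    Emb (.node a b) (.node a' b') :=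
  (ha.lift (DyckTree.node · b) fun _ _ h => .left b h).trans
    (hb.lift (DyckTree.node a' ·) fun _ _ h => .right a' h)

end DyckTree

theorem Matches.lt {t : DyckTree} {i j : ℕ} (h : Matches t i j) :
    i < j ∧ j < t.yield.length := by
  induction h <;> simp only [DyckTree.yield, List.length_cons, List.length_append] <;> omega

theorem eraseIdx_pair_head (x y : List D) :
    ((D.ab :: (x ++ D.a :: y)).eraseIdx (x.length + 1)).eraseIdx 0 = x ++ y := by
  simp [List.eraseIdx_append_of_length_le]

theorem eraseIdx_pair_left {x : List D} (y : List D) {i j : ℕ} (hij : i < j)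
    (hj : j < x.length) :
    ((D.ab :: (x ++ D.a :: y)).eraseIdx (j + 1)).eraseIdx (i + 1) =
      D.ab :: ((x.eraseIdx j).eraseIdx i ++ D.a :: y) := by
  have hi : i < (x.eraseIdx j).length := by
    rw [List.length_eraseIdx_of_lt hj]
    omega
  rw [List.eraseIdx_cons_succ, List.eraseIdx_append_of_lt_length hj, List.eraseIdx_cons_succ,
    List.eraseIdx_append_of_lt_length hi]

theorem eraseIdx_pair_right (x y : List D) (i j : ℕ) :
    ((D.ab :: (x ++ D.a :: y)).eraseIdx (x.length + 2 + j)).eraseIdx (x.length + 2 + i) =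
      D.ab :: (x ++ D.a :: (y.eraseIdx j).eraseIdx i) := by
  have split : ∀ z : List D, D.ab :: (x ++ D.a :: z) = (D.ab :: (x ++ [D.a])) ++ z := by simp
  have drop : ∀ (z : List D) (n : ℕ),
      (D.ab :: (x ++ D.a :: z)).eraseIdx (x.length + 2 + n) =
        D.ab :: (x ++ D.a :: z.eraseIdx n) := by
    intro z n
    rw [split, split, List.eraseIdx_append_of_length_le (by simp)]
    simp
  rw [drop, drop]

theorem Matches.exists_del {t : DyckTree} {i j : ℕ} (h : Matches t i j) :
    ∃ s, t.Del s ∧ s.yield = (t.yield.eraseIdx j).eraseIdx i := by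
  induction h with
  | head a b =>
    exact ⟨_, .head a b, by rw [DyckTree.yield_append, DyckTree.yield, eraseIdx_pair_head]⟩
  | left b h ih =>
    obtain ⟨s, hs, hy⟩ := ih
    exact ⟨_, .left b hs, by
      rw [DyckTree.yield, DyckTree.yield, eraseIdx_pair_left _ h.lt.1 h.lt.2, hy]⟩
  | right a h ih =>
    obtain ⟨s, hs, hy⟩ := ih
    exact ⟨_, .right a hs, by rw [DyckTree.yield, DyckTree.yield, eraseIdx_pair_right, hy]⟩

theorem DyckTree.Del.exists_matches {t s : DyckTree} (h : t.Del s) :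
    ∃ i j, Matches t i j ∧ s.yield = (t.yield.eraseIdx j).eraseIdx i := by
  induction h with
  | head a b =>
    exact ⟨_, _, .head a b, by rw [DyckTree.yield_append, DyckTree.yield, eraseIdx_pair_head]⟩
  | left b _ ih =>
    obtain ⟨i, j, h, hy⟩ := ih
    exact ⟨_, _, .left b h, by
      rw [DyckTree.yield, DyckTree.yield, eraseIdx_pair_left _ h.lt.1 h.lt.2, hy]⟩
  | right a _ ih =>
    obtain ⟨i, j, h, hy⟩ := ih
    exact ⟨_, _, .right a h, by rw [DyckTree.yield, DyckTree.yield, eraseIdx_pair_right, hy]⟩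

theorem dyckLE_yield_iff {t s : DyckTree} : dyckLE s.yield t.yield ↔ t.Emb s := by
  constructor
  · intro h
    suffices ∀ w, dyckLE s.yield w → ∀ t : DyckTree, t.yield = w → t.Emb s from this _ h _ rfl
    intro w hw
    induction hw using Relation.ReflTransGen.head_induction_on with
    | refl =>
      intro t ht
      rw [DyckTree.yield_injective ht]
    | head hstep _ ih =>
      rintro t rfl
      obtain ⟨t', i, j, ht', hm, rfl⟩ := hstep
      obtain rfl := DyckTree.yield_injective ht'
      obtain ⟨u, hu, hy⟩ := hm.exists_del
      exact .head hu (ih u hy)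
  · intro h
    refine h.lift DyckTree.yield fun t s hts => ?_
    obtain ⟨i, j, hm, hy⟩ := hts.exists_matches
    exact ⟨t, i, j, rfl, hm, hy⟩

namespace DyckTree

/-- Some tree of the forest has a subforest below its root satisfying `P`. -/
def HatIn (P : DyckTree → Prop) : DyckTree → Prop
  | .eps => False
  | .node a b => P a ∨ HatIn P b

/-- Two disjoint trees in the forest have subforests below their roots satisfying `P`. -/
def PairIn (P : DyckTree → Prop) : DyckTree → Prop
  | .eps => False
  | .node a b => PairIn P a ∨ PairIn P b ∨ (P a ∧ HatIn P b)

/-- A property of forests inherited by every forest from which nodes are deleted. -/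
def UpClosed (P : DyckTree → Prop) : Prop := ∀ ⦃t s : DyckTree⦄, Del t s → P s → P t

theorem UpClosed.of_emb {P : DyckTree → Prop} (hP : UpClosed P) {t s : DyckTree}
    (h : Emb t s) (hs : P s) : P t := by
  induction h using Relation.ReflTransGen.head_induction_on with
  | refl => exact hs
  | head h _ ih => exact hP h ih

theorem HatIn.of_append {P : DyckTree → Prop} {a b : DyckTree}
    (h : HatIn P (a.append b)) : HatIn P a ∨ HatIn P b := by
  induction a with
  | eps => exact .inr h
  | node a₁ a₂ _ ih =>
    rcases h with h | h
    · exact .inl (.inl h)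
    · exact (ih h).imp .inr id

theorem HatIn.self {P : DyckTree → Prop} (hP : UpClosed P) {t : DyckTree} (h : HatIn P t) :
    P t := by
  induction t with
  | eps => exact h.elim
  | node a b _ ihb =>
    rcases h with h | h
    · exact hP.of_emb (emb_node_left a b) h
    · exact hP.of_emb (emb_node_right a b) (ihb h)

theorem PairIn.of_append {P : DyckTree → Prop} (hP : UpClosed P) {a b : DyckTree}
    (h : PairIn P (a.append b)) : PairIn P (.node a b) := by
  induction a with
  | eps => exact .inr (.inl h)
  | node a₁ a₂ _ ih =>
    rcases h with h | h | ⟨h₁, h₂⟩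
    · exact .inl (.inl h)
    · rcases ih h with h | h | ⟨h₁, h₂⟩
      · exact .inl (.inr (.inl h))
      · exact .inr (.inl h)
      · exact .inr (.inr ⟨hP.of_emb (emb_node_right a₁ a₂) h₁, h₂⟩)
    · rcases h₂.of_append with h₂ | h₂
      · exact .inl (.inr (.inr ⟨h₁, h₂⟩))
      · exact .inr (.inr ⟨hP.of_emb (emb_node_left a₁ a₂) h₁, h₂⟩)

theorem UpClosed.hatIn {P : DyckTree → Prop} (hP : UpClosed P) : UpClosed (HatIn P) := by
  intro t s h
  induction h with
  | head a b => exact fun h => h.of_append.imp (HatIn.self hP) id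
  | left b h _ => exact Or.imp (hP h) id
  | right a _ ih => exact Or.imp id ih

theorem UpClosed.pairIn {P : DyckTree → Prop} (hP : UpClosed P) : UpClosed (PairIn P) := by
  intro t s h
  induction h with
  | head a b => exact PairIn.of_append hP
  | left b h ih => exact Or.imp ih (Or.imp id (And.imp (hP h) id))
  | right a h ih => exact Or.imp id (Or.imp ih (And.imp id (hP.hatIn h)))

theorem HatIn.mono {P Q : DyckTree → Prop} (hPQ : ∀ t, P t → Q t) {t : DyckTree}
    (h : HatIn P t) : HatIn Q t := by
  induction t with
  | eps => exact h
  | node a b _ ihb => exact Or.imp (hPQ a) ihb h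

theorem PairIn.mono {P Q : DyckTree → Prop} (hPQ : ∀ t, P t → Q t) {t : DyckTree}
    (h : PairIn P t) : PairIn Q t := by
  induction t with
  | eps => exact h
  | node a b iha ihb =>
    exact Or.imp iha (Or.imp ihb (And.imp (hPQ a) (HatIn.mono hPQ))) h

theorem HatIn.emb {P : DyckTree → Prop} {u : DyckTree} (hP : ∀ t, P t → Emb t u)
    {t : DyckTree} (h : HatIn P t) : Emb t (.node u .eps) := by
  induction t with
  | eps => exact h.elim
  | node a b _ ihb =>
    rcases h with h | h
    · exact (hP a h).node (emb_eps b)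
    · exact (emb_node_right a b).trans (ihb h)

theorem PairIn.emb {P : DyckTree → Prop} {u : DyckTree} (hP : ∀ t, P t → Emb t u)
    {t : DyckTree} (h : PairIn P t) : Emb t (.node u (.node u .eps)) := by
  induction t with
  | eps => exact h.elim
  | node a b iha ihb =>
    rcases h with h | h | ⟨h₁, h₂⟩
    · exact (emb_node_left a b).trans (iha h)
    · exact (emb_node_right a b).trans (ihb h)
    · exact (hP a h₁).node (h₂.emb hP)

/-- The harmonic `h_q` embeds into the forest. -/
def HarmIn : ℕ → DyckTree → Prop
  | 0 => fun _ => True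
  | q + 1 => PairIn (HarmIn q)

/-- The parse tree of the harmonic `h_q`. -/
def harmonic : ℕ → DyckTree
  | 0 => .eps
  | q + 1 => .node (harmonic q) (.node (harmonic q) .eps)

theorem yield_harmonic (q : ℕ) : (harmonic q).yield = harmonicW q := by
  induction q with
  | zero => rfl
  | succ q ih => simp [harmonic, harmonicW, yield, ih]

theorem yield_node_harmonic_eps (q : ℕ) :
    (DyckTree.node (harmonic q) .eps).yield = hatHarmonic q := by
  simp [yield, hatHarmonic, yield_harmonic]

theorem upClosed_harmIn (q : ℕ) : UpClosed (HarmIn q) := by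
  induction q with
  | zero => exact fun _ _ _ _ => trivial
  | succ q ih => exact ih.pairIn

theorem HarmIn.emb {q : ℕ} {t : DyckTree} (h : HarmIn q t) : Emb t (harmonic q) := by
  induction q generalizing t with
  | zero => exact emb_eps t
  | succ q ih => exact PairIn.emb (fun _ => ih) h

theorem harmIn_harmonic (q : ℕ) : HarmIn q (harmonic q) := by
  induction q with
  | zero => trivial
  | succ q ih => exact .inr (.inr ⟨ih, .inl ih⟩)

theorem dyckLE_harmonicW_yield_iff {q : ℕ} {t : DyckTree} :
    dyckLE (harmonicW q) t.yield ↔ HarmIn q t := by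
  rw [← yield_harmonic, dyckLE_yield_iff]
  exact ⟨fun h => (upClosed_harmIn q).of_emb h (harmIn_harmonic q), HarmIn.emb⟩

theorem dyckLE_hatHarmonic_yield_of_hatIn {q : ℕ} {t : DyckTree} (h : HatIn (HarmIn q) t) :
    dyckLE (hatHarmonic q) t.yield := by
  rw [← yield_node_harmonic_eps, dyckLE_yield_iff]
  exact h.emb fun _ => HarmIn.emb

theorem HarmIn.of_succ {q : ℕ} {t : DyckTree} (h : HarmIn (q + 1) t) : HarmIn q t := by
  induction q generalizing t with
  | zero => trivial
  | succ q ih => exact PairIn.mono (fun _ => ih) h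

theorem HarmIn.of_le {p q : ℕ} (hpq : p ≤ q) {t : DyckTree} (h : HarmIn q t) :
    HarmIn p t := by
  induction q, hpq using Nat.le_induction with
  | base => exact h
  | succ q _ ih => exact ih h.of_succ

/-- The footprint `ā a β` has the oscillation prescribed by the annotation `d` or `d̂`. -/
structure Oscillates (d : ℕ) (hat : Bool) (β : DyckTree) : Prop where
  harm : hat = false → HarmIn d (.node .eps β)
  hatHarm : hat = true → HatIn (HarmIn d) (.node .eps β)
  not_succ : ¬ HarmIn (d + 1) (.node .eps β)

theorem oscillates_eps (hat : Bool) : Oscillates 0 hat .eps :=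
  ⟨fun _ => trivial, fun _ => .inl trivial, by simp [HarmIn, PairIn, HatIn]⟩

theorem not_harmIn_succ_push {d : ℕ} {β₁ β₂ : DyckTree}
    (h₁ : ¬ HarmIn (d + 2) (.node .eps β₁)) (h₂ : ¬ HarmIn (d + 2) (.node .eps β₂))
    (h : ¬ HarmIn (d + 1) (.node .eps β₁) ∨ ¬ HarmIn (d + 1) (.node .eps β₂)) :
    ¬ HarmIn (d + 2) (.node .eps (.node (.node .eps β₁) β₂)) := by
  rintro (h' | (h' | h' | ⟨h₁', h₂'⟩) | ⟨h', -⟩)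
  · exact h'
  · exact h₁ h'
  · exact h₂ (.inr (.inl h'))
  · refine h.elim (· h₁') (· ?_)
    exact (upClosed_harmIn _).of_emb (emb_node_right .eps β₂) (h₂'.self (upClosed_harmIn _))
  · exact h'

theorem Oscillates.push_left {d ℓ : ℕ} {β₁ β₂ : DyckTree} {hat : Bool} (hℓ : ℓ ≤ d)
    (h₁ : Oscillates (d + 1) false β₁) (h₂ : Oscillates ℓ false β₂) :
    Oscillates (d + 1) hat (.node (.node .eps β₁) β₂) where
  harm _ := .inr (.inl (.inl (h₁.harm rfl)))
  hatHarm _ := .inr (.inl (h₁.harm rfl))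
  not_succ := not_harmIn_succ_push h₁.not_succ
    (fun h => h₂.not_succ (h.of_le (by omega))) (.inr fun h => h₂.not_succ (h.of_le (by omega)))

theorem Oscillates.push_right {d ℓ : ℕ} {β₁ β₂ : DyckTree} {hat : Bool} (hℓ : ℓ ≤ d)
    (h₁ : Oscillates ℓ false β₁) (h₂ : Oscillates (d + 1) hat β₂) :
    Oscillates (d + 1) hat (.node (.node .eps β₁) β₂) where
  harm h := (upClosed_harmIn (d + 1)).of_emb
    (Emb.node .refl (emb_node_right _ _)) (h₂.harm h)
  hatHarm h := (upClosed_harmIn (d + 1)).hatIn.of_emb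
    (Emb.node .refl (emb_node_right _ _)) (h₂.hatHarm h)
  not_succ := not_harmIn_succ_push (fun h => h₁.not_succ (h.of_le (by omega)))
    h₂.not_succ (.inl fun h => h₁.not_succ (h.of_le (by omega)))

theorem Oscillates.push_both {d : ℕ} {β₁ β₂ : DyckTree}
    (h₁ : Oscillates d false β₁) (h₂ : Oscillates d true β₂) :
    Oscillates (d + 1) false (.node (.node .eps β₁) β₂) where
  harm _ := by
    rcases h₂.hatHarm rfl with h | h
    · exact .inr (.inr ⟨h, .inl (h₁.harm rfl)⟩)
    · exact .inr (.inl (.inr (.inr ⟨h₁.harm rfl, h⟩)))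
  hatHarm h := by simp at h
  not_succ := not_harmIn_succ_push (fun h => h₁.not_succ h.of_succ)
    (fun h => h₂.not_succ h.of_succ) (.inl h₁.not_succ)

end DyckTree

open DyckTree in
theorem alphaQR'_eq_flatMap {σ Γ : Type} (P : PDA PUnit σ Γ) (k : ℕ)
    (r : List (ID PUnit σ (AnnSym Γ))) (hr : r.IsChain (annPDA P k).Move)
    (I I' : ID PUnit σ (AnnSym Γ)) (hI : r.head? = some I) (hI' : r.getLast? = some I')
    (hstack : I'.stack = []) :
    ∃ βs : List DyckTree,
      List.Forall₂ (fun (s : AnnSym Γ) β => Oscillates s.2.1 s.2.2 β) I.stack βs ∧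
      alphaQR' r = βs.flatMap fun β => D.a :: β.yield := by
  induction r generalizing I with
  | nil => simp at hI
  | cons J r ih =>
    obtain rfl : J = I := by simpa using hI
    cases r with
    | nil =>
      obtain rfl : J = I' := by simpa using hI'
      exact ⟨[], by simp [hstack], rfl⟩
    | cons K r =>
      obtain ⟨hmove, hchain⟩ := List.isChain_cons_cons.mp hr
      obtain ⟨βs, hβs, hα⟩ := ih hchain K rfl (by simpa using hI')
      obtain ⟨b, s, ξ, rest, hact, hJ, hK, -⟩ := hmove
      have pop (hξ : ξ = []) (h : Oscillates s.2.1 s.2.2 .eps) : ∃ βs : List DyckTree,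
          List.Forall₂ (fun (s : AnnSym Γ) β => Oscillates s.2.1 s.2.2 β) J.stack βs ∧
          alphaQR' (J :: K :: r) = βs.flatMap fun β => D.a :: β.yield := by
        subst hξ
        rw [List.nil_append] at hK
        refine ⟨.eps :: βs, by rw [hJ]; exact .cons h (hK ▸ hβs), ?_⟩
        simp [alphaQR', hα, hJ, hK, DyckTree.yield]
      have push (s₁ s₂ : AnnSym Γ) (hξ : ξ = [s₁, s₂])
          (h : ∀ β₁ β₂, Oscillates s₁.2.1 s₁.2.2 β₁ → Oscillates s₂.2.1 s₂.2.2 β₂ →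
            Oscillates s.2.1 s.2.2 (.node (.node .eps β₁) β₂)) : ∃ βs : List DyckTree,
          List.Forall₂ (fun (s : AnnSym Γ) β => Oscillates s.2.1 s.2.2 β) J.stack βs ∧
          alphaQR' (J :: K :: r) = βs.flatMap fun β => D.a :: β.yield := by
        subst hξ
        rw [hK] at hβs
        obtain _ | ⟨h₁, _ | ⟨h₂, hrest⟩⟩ := hβs
        refine ⟨_ :: _, by rw [hJ]; exact .cons (h _ _ h₁ h₂) hrest, ?_⟩
        have hlen : K.stack.length + 1 - J.stack.length = 2 := by
          simp [hJ, hK]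
        simp [alphaQR', hα, hlen, DyckTree.yield, List.replicate]
      rcases hact with ⟨b', γ, hat, -, h⟩ | ⟨b', γ, ξ₁, ξ₂, d, ℓ, -, hd, -, hℓ, h⟩ |
        ⟨b', γ, ξ₁, ξ₂, d, -, hd, -, h⟩
      · simp only [Prod.mk.injEq] at h
        obtain ⟨-, -, rfl, -, hξ⟩ := h
        exact pop hξ (oscillates_eps hat)
      · obtain ⟨d, rfl⟩ := Nat.exists_eq_add_of_le' hd
        simp only [Prod.mk.injEq] at h
        rcases h with ⟨-, -, rfl, -, hξ⟩ | ⟨-, -, rfl, -, hξ⟩ | ⟨-, -, rfl, -, hξ⟩ |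
          ⟨-, -, rfl, -, hξ⟩
        · exact push _ _ hξ fun _ _ => Oscillates.push_left hℓ
        · exact push _ _ hξ fun _ _ => Oscillates.push_right hℓ
        · exact push _ _ hξ fun _ _ => Oscillates.push_left hℓ
        · exact push _ _ hξ fun _ _ => Oscillates.push_right hℓ
      · obtain ⟨d, rfl⟩ := Nat.exists_eq_add_of_le' hd
        simp only [Prod.mk.injEq] at h
        obtain ⟨-, -, rfl, -, hξ⟩ := h
        exact push _ _ hξ fun _ _ => Oscillates.push_both

/-!
STATEMENT 14: Let `P` be a PDA in reduced form, let `k ≥ 1`, and let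
`r = I₀, …, I_m` be a quasi-run of the `k`-oscillating PDA `P^(k)`.
If `annot(stack(I₀)) = d`, then `h_d ≼ α(r)` and `h_{d+1} ⋠ α(r)` (so `r` is
`d`-oscillating); if `annot(stack(I₀)) = d̂`, then `ĥ_d ≼ α(r)` and `h_{d+1} ⋠ α(r)`.
-/

theorem annPDA_quasiRun {σ Γ : Type} [Finite σ] [Finite Γ]
    (P : PDA PUnit σ Γ) (hP : P.Reduced) (k : ℕ) (hk : 1 ≤ k)
    (r : List (ID PUnit σ (AnnSym Γ))) (hr : (annPDA P k).IsQuasiRun r)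
    (I₀ : ID PUnit σ (AnnSym Γ)) (hI₀ : r.head? = some I₀)
    (γ : Γ) (d : ℕ) (hat : Bool) (hstack : I₀.stack = [(γ, d, hat)]) :
    (hat = false → dyckLE (harmonicW d) (alphaQR r) ∧
      ¬ dyckLE (harmonicW (d + 1)) (alphaQR r)) ∧
    (hat = true → dyckLE (hatHarmonic d) (alphaQR r) ∧
      ¬ dyckLE (harmonicW (d + 1)) (alphaQR r)) := by
  obtain ⟨hchain, -, I', hI', hempty⟩ := hr
  obtain ⟨βs, hβs, hα⟩ := alphaQR'_eq_flatMap P k r hchain I₀ I' hI₀ hI' hempty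
  rw [hstack] at hβs
  obtain _ | ⟨hosc, _ | _⟩ := hβs
  rename_i β
  have hfoot : alphaQR r = (DyckTree.node .eps β).yield := by
    simp [alphaQR, hα, DyckTree.yield]
  rw [hfoot, DyckTree.dyckLE_harmonicW_yield_iff, DyckTree.dyckLE_harmonicW_yield_iff]
  exact ⟨fun h => ⟨hosc.harm h, hosc.not_succ⟩,
    fun h => ⟨DyckTree.dyckLE_hatHarmonic_yield_of_hatIn (hosc.hatHarm h), hosc.not_succ⟩⟩
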